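/- Let (u, N, p) be a classical solution of the damped Navier–Stokes–Bardina equations with initial datum u₀ and force f. Then for all t ≥ 0 and all T ≥ 0: ν ∫ₜ^{t+T} ‖u(s,·)‖²_{Ḣ¹} ds + να² ∫ₜ^{t+T} ‖u(s,·)‖²_{Ḣ²} ds ≤ (2T/β) ( ‖f‖²_{L²} + α²‖f‖²_{Ḣ¹} ) + ‖u(t,·)‖²_{L²} + α²‖u(t,·)‖²_{Ḣ¹}. -/

import Mathlib

open MeasureTheory Set

noncomputable section

abbrev V3 : Type := Fin 3 → ℝ

def pd (j : Fin 3) (g : V3 → Fin 3 → ℝ) : V3 → Fin 3 → ℝ :=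
  fun x => fderiv ℝ g x (Pi.single j 1)

def pdS (j : Fin 3) (g : V3 → ℝ) : V3 → ℝ :=
  fun x => fderiv ℝ g x (Pi.single j 1)

def L2sq (g : V3 → Fin 3 → ℝ) : ℝ := ∫ x : V3, ∑ i, (g x i)^2
def H1sq (g : V3 → Fin 3 → ℝ) : ℝ := ∫ x : V3, ∑ i, ∑ j, (pd j g x i)^2
def H2sq (g : V3 → Fin 3 → ℝ) : ℝ := ∫ x : V3, ∑ i, ∑ j, ∑ k, (pd k (pd j g) x i)^2
def H1aSq (α : ℝ) (g : V3 → Fin 3 → ℝ) : ℝ := L2sq g + α^2 * H1sq g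

def IsSchwartz {F : Type*} [NormedAddCommGroup F] [NormedSpace ℝ F] (g : V3 → F) : Prop :=
  ContDiff ℝ (⊤ : ℕ∞) g ∧ ∀ (k n : ℕ), ∃ C : ℝ, ∀ x : V3, ‖x‖ ^ k * ‖iteratedFDeriv ℝ n g x‖ ≤ C

def IsForce (f : V3 → Fin 3 → ℝ) : Prop :=
  IsSchwartz f ∧ ∀ x, (∑ j, pd j f x j) = 0

def SchwartzLocBdd {F : Type*} [NormedAddCommGroup F] [NormedSpace ℝ F]
    (g : ℝ → V3 → F) : Prop :=
  ContDiffOn ℝ (⊤ : ℕ∞) (fun q : ℝ × V3 => g q.1 q.2) (Set.Ici (0:ℝ) ×ˢ Set.univ) ∧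
  ∀ T > (0:ℝ), ∀ (k n : ℕ), ∃ C : ℝ, ∀ t ∈ Set.Icc (0:ℝ) T, ∀ x : V3,
    ‖x‖ ^ k * ‖iteratedFDeriv ℝ n (g t) x‖ ≤ C

structure ClassicalSolution (α β ν : ℝ) (u₀ f : V3 → Fin 3 → ℝ) where
  u : ℝ → V3 → Fin 3 → ℝ
  N : ℝ → V3 → Fin 3 → ℝ
  p : ℝ → V3 → ℝ
  reg_u : SchwartzLocBdd u
  reg_N : SchwartzLocBdd N
  reg_p : SchwartzLocBdd p
  divFree : ∀ t ≥ (0:ℝ), ∀ x, (∑ j, pd j (u t) x j) = 0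
  filter : ∀ t ≥ (0:ℝ), ∀ x i, -α^2 * (∑ j, pd j (pd j (N t)) x i) + N t x i
      = ∑ j, u t x j * pd j (u t) x i
  momentum : ∀ t ≥ (0:ℝ), ∀ x i,
      derivWithin (fun s => u s x i) (Set.Ici (0:ℝ)) t + N t x i
        - ν * (∑ j, pd j (pd j (u t)) x i) + pdS i (p t) x
      = f x i - β * u t x i
  init : ∀ x, u 0 x = u₀ x

namespace SchwartzLocBdd

variable {g h : ℝ → V3 → ℝ}

theorem contDiff_slice {F : Type*} [NormedAddCommGroup F] [NormedSpace ℝ F] {g : ℝ → V3 → F}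
    (hg : SchwartzLocBdd g) {t : ℝ} (ht : 0 ≤ t) : ContDiff ℝ (⊤ : ℕ∞) (g t) := by
  rw [← contDiffOn_univ]
  exact hg.1.comp (f := fun x : V3 => (t, x)) (by fun_prop) fun x _ => ⟨ht, mem_univ _⟩

theorem clm_comp {F G : Type*} [NormedAddCommGroup F] [NormedSpace ℝ F]
    [NormedAddCommGroup G] [NormedSpace ℝ G] {g : ℝ → V3 → F} (hg : SchwartzLocBdd g)
    (L : F →L[ℝ] G) : SchwartzLocBdd fun t x => L (g t x) := by
  refine ⟨L.contDiff.comp_contDiffOn hg.1, fun T hT k n => ?_⟩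
  obtain ⟨C, hC⟩ := hg.2 T hT k n
  refine ⟨‖L‖ * C, fun t ht x => ?_⟩
  have hle := L.norm_iteratedFDeriv_comp_left (x := x) (n := n)
    ((hg.contDiff_slice ht.1).contDiffAt (x := x)) (by exact_mod_cast le_top)
  calc ‖x‖ ^ k * ‖iteratedFDeriv ℝ n (fun x => L (g t x)) x‖
      ≤ ‖x‖ ^ k * (‖L‖ * ‖iteratedFDeriv ℝ n (g t) x‖) := by gcongr; exact hle
    _ = ‖L‖ * (‖x‖ ^ k * ‖iteratedFDeriv ℝ n (g t) x‖) := by ring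
    _ ≤ ‖L‖ * C := by gcongr; exact hC t ht x

theorem of_isSchwartz {F : Type*} [NormedAddCommGroup F] [NormedSpace ℝ F] {f : V3 → F}
    (hf : IsSchwartz f) : SchwartzLocBdd fun _ : ℝ => f :=
  ⟨(hf.1.comp contDiff_snd).contDiffOn, fun _ _ k n =>
    let ⟨C, hC⟩ := hf.2 k n
    ⟨C, fun _ _ x => hC x⟩⟩

theorem slice {F : Type*} [NormedAddCommGroup F] [NormedSpace ℝ F] {g : ℝ → V3 → F}
    (hg : SchwartzLocBdd g) {t : ℝ} (ht : 0 ≤ t) : IsSchwartz (g t) :=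
  ⟨hg.contDiff_slice ht, fun k n =>
    let ⟨C, hC⟩ := hg.2 (t + 1) (by linarith) k n
    ⟨C, fun x => hC t ⟨ht, by linarith⟩ x⟩⟩

theorem add (hg : SchwartzLocBdd g) (hh : SchwartzLocBdd h) :
    SchwartzLocBdd fun t x => g t x + h t x := by
  refine ⟨hg.1.add hh.1, fun T hT k n => ?_⟩
  obtain ⟨C, hC⟩ := hg.2 T hT k n
  obtain ⟨D, hD⟩ := hh.2 T hT k n
  refine ⟨C + D, fun t ht x => ?_⟩
  have heq : iteratedFDeriv ℝ n (fun x => g t x + h t x) x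
      = iteratedFDeriv ℝ n (g t) x + iteratedFDeriv ℝ n (h t) x :=
    iteratedFDeriv_add_apply
      (((hg.contDiff_slice ht.1).of_le (by exact_mod_cast le_top)).contDiffAt)
      (((hh.contDiff_slice ht.1).of_le (by exact_mod_cast le_top)).contDiffAt)
  rw [heq]
  calc _ ≤ ‖x‖ ^ k * (‖iteratedFDeriv ℝ n (g t) x‖ + ‖iteratedFDeriv ℝ n (h t) x‖) := by
        gcongr; exact norm_add_le _ _
    _ ≤ C + D := by rw [mul_add]; exact add_le_add (hC t ht x) (hD t ht x)

theorem const_mul (c : ℝ) (hg : SchwartzLocBdd g) : SchwartzLocBdd fun t x => c * g t x :=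
  hg.clm_comp (ContinuousLinearMap.mul ℝ ℝ c)

theorem sub (hg : SchwartzLocBdd g) (hh : SchwartzLocBdd h) :
    SchwartzLocBdd fun t x => g t x - h t x := by
  simpa [sub_eq_add_neg] using hg.add (hh.const_mul (-1))

theorem zero : SchwartzLocBdd fun (_ : ℝ) (_ : V3) => (0 : ℝ) := by
  refine of_isSchwartz ⟨contDiff_const, fun k n => ⟨0, fun x => ?_⟩⟩
  rw [show (fun _ : V3 => (0 : ℝ)) = 0 from rfl]
  simp

theorem sum {ι : Type*} (s : Finset ι) {G : ι → ℝ → V3 → ℝ}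
    (hG : ∀ i, SchwartzLocBdd (G i)) : SchwartzLocBdd fun t x => ∑ i ∈ s, G i t x := by
  classical
  induction s using Finset.induction_on with
  | empty => simpa using zero
  | insert a s ha ih => simpa [Finset.sum_insert ha] using (hG a).add ih

theorem mul (hg : SchwartzLocBdd g) (hh : SchwartzLocBdd h) :
    SchwartzLocBdd fun t x => g t x * h t x := by
  refine ⟨hg.1.mul hh.1, fun T hT k n => ?_⟩
  choose C hC using hg.2 T hT k
  choose D hD using hh.2 T hT 0
  refine ⟨∑ i ∈ Finset.range (n + 1), (n.choose i : ℝ) * C i * D (n - i), fun t ht x => ?_⟩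
  refine (mul_le_mul_of_nonneg_left (norm_iteratedFDeriv_mul_le (hg.contDiff_slice ht.1)
    (hh.contDiff_slice ht.1) x (by exact_mod_cast le_top)) (by positivity)).trans ?_
  rw [Finset.mul_sum]
  refine Finset.sum_le_sum fun i _ => ?_
  have h1 := hC i t ht x
  have h2 := hD (n - i) t ht x
  rw [pow_zero, one_mul] at h2
  have h0 : 0 ≤ C i := le_trans (by positivity) h1
  calc _ = (n.choose i : ℝ) * (‖x‖ ^ k * ‖iteratedFDeriv ℝ i (g t) x‖)
        * ‖iteratedFDeriv ℝ (n - i) (h t) x‖ := by ring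
    _ ≤ _ := by gcongr

theorem pdS (j : Fin 3) (hg : SchwartzLocBdd g) : SchwartzLocBdd fun t => pdS j (g t) := by
  have hS : UniqueDiffOn ℝ (Ici (0 : ℝ) ×ˢ (univ : Set V3)) :=
    (uniqueDiffOn_Ici 0).prod uniqueDiffOn_univ
  refine ⟨?_, fun T hT k n => ?_⟩
  · have hD := (hg.1.fderivWithin hS (m := (⊤ : ℕ∞)) (by simp)).clm_apply
      (contDiffOn_const (c := ((0 : ℝ), (Pi.single j 1 : V3))))
    refine hD.congr fun q hq => ?_
    have hF := (hg.1.differentiableOn (by simp) q hq).hasFDerivWithinAt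
    have hc : HasFDerivWithinAt (fun x : V3 => (q.1, x)) (ContinuousLinearMap.inr ℝ ℝ V3)
        univ q.2 := (hasFDerivAt_prodMk_right q.1 q.2).hasFDerivWithinAt
    have := (hF.comp (f := fun x : V3 => (q.1, x)) q.2 hc fun x _ => ⟨hq.1, mem_univ _⟩)
    rw [hasFDerivWithinAt_univ] at this
    change fderiv ℝ (g q.1) q.2 _ = _
    rw [show g q.1 = (fun q : ℝ × V3 => g q.1 q.2) ∘ fun x : V3 => (q.1, x) from rfl,
      this.fderiv]
    simp
  · obtain ⟨C, hC⟩ := hg.2 T hT k (n + 1)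
    let L : (V3 →L[ℝ] ℝ) →L[ℝ] ℝ := ContinuousLinearMap.apply ℝ ℝ (Pi.single j 1 : V3)
    refine ⟨‖L‖ * C, fun t ht x => ?_⟩
    have hle := L.norm_iteratedFDeriv_comp_left (x := x) (n := n)
      (((hg.contDiff_slice ht.1).fderiv_right (m := (⊤ : ℕ∞)) (by simp)).contDiffAt (x := x))
      (by exact_mod_cast le_top)
    rw [norm_iteratedFDeriv_fderiv] at hle
    calc _ ≤ ‖x‖ ^ k * (‖L‖ * ‖iteratedFDeriv ℝ (n + 1) (g t) x‖) := by gcongr; exact hle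
      _ = ‖L‖ * (‖x‖ ^ k * ‖iteratedFDeriv ℝ (n + 1) (g t) x‖) := by ring
      _ ≤ ‖L‖ * C := by gcongr; exact hC t ht x

theorem exists_integrable_bound (hg : SchwartzLocBdd g) {T : ℝ} (hT : 0 < T) :
    ∃ b : V3 → ℝ, Integrable b ∧ ∀ t ∈ Icc 0 T, ∀ x, ‖g t x‖ ≤ b x := by
  obtain ⟨C, hC⟩ := hg.2 T hT 0 0
  obtain ⟨D, hD⟩ := hg.2 T hT 4 0
  refine ⟨fun x => 8 * (C + D) * (1 + ‖x‖) ^ (-(4 : ℝ)),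
    (integrable_one_add_norm (by simp; norm_num)).const_mul _, fun t ht x => ?_⟩
  have h1 := hC t ht x
  have h2 := hD t ht x
  rw [norm_iteratedFDeriv_zero] at h1 h2
  have h3 : (1 + ‖x‖) ^ 4 ≤ 8 * (1 + ‖x‖ ^ 4) := by
    nlinarith [sq_nonneg (‖x‖ - 1), sq_nonneg (‖x‖ ^ 2 - 1), sq_nonneg (‖x‖ ^ 2 - ‖x‖)]
  beta_reduce
  rw [Real.rpow_neg (by positivity), ← div_eq_mul_inv, le_div_iff₀ (by positivity),
    show (4 : ℝ) = ((4 : ℕ) : ℝ) by norm_num, Real.rpow_natCast]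
  calc ‖g t x‖ * (1 + ‖x‖) ^ 4 ≤ ‖g t x‖ * (8 * (1 + ‖x‖ ^ 4)) := by gcongr
    _ = 8 * (‖x‖ ^ 0 * ‖g t x‖ + ‖x‖ ^ 4 * ‖g t x‖) := by ring
    _ ≤ 8 * (C + D) := by gcongr

theorem exists_bound (hg : SchwartzLocBdd g) {T : ℝ} (hT : 0 < T) :
    ∃ C : ℝ, ∀ t ∈ Icc 0 T, ∀ x, ‖g t x‖ ≤ C := by
  obtain ⟨C, hC⟩ := hg.2 T hT 0 0
  exact ⟨C, fun t ht x => by simpa using hC t ht x⟩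

theorem contDiffOn_time (hg : SchwartzLocBdd g) (x : V3) :
    ContDiffOn ℝ (⊤ : ℕ∞) (fun t => g t x) (Ici 0) :=
  hg.1.comp (f := fun t : ℝ => (t, x)) (by fun_prop) fun _ ht => ⟨ht, mem_univ _⟩

theorem continuousOn_integral (hg : SchwartzLocBdd g) (T : ℝ) :
    ContinuousOn (fun t => ∫ x, g t x) (Icc 0 T) := by
  rcases le_or_gt T 0 with hT | hT
  · rcases hT.lt_or_eq with h | rfl
    · simp [Icc_eq_empty_of_lt h]
    · simp
  obtain ⟨b, hb, hgb⟩ := hg.exists_integrable_bound hT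
  exact continuousOn_of_dominated
    (fun t ht => (hg.contDiff_slice ht.1).continuous.aestronglyMeasurable)
    (fun t ht => .of_forall fun x => hgb t ht x) hb
    (.of_forall fun x => (hg.contDiffOn_time x).continuousOn.mono Icc_subset_Ici_self)

end SchwartzLocBdd

namespace IsSchwartz

variable {f g : V3 → ℝ}

theorem add (hf : IsSchwartz f) (hg : IsSchwartz g) : IsSchwartz fun x => f x + g x :=
  ((SchwartzLocBdd.of_isSchwartz hf).add (.of_isSchwartz hg)).slice le_rfl

theorem sub (hf : IsSchwartz f) (hg : IsSchwartz g) : IsSchwartz fun x => f x - g x :=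
  ((SchwartzLocBdd.of_isSchwartz hf).sub (.of_isSchwartz hg)).slice le_rfl

theorem mul (hf : IsSchwartz f) (hg : IsSchwartz g) : IsSchwartz fun x => f x * g x :=
  ((SchwartzLocBdd.of_isSchwartz hf).mul (.of_isSchwartz hg)).slice le_rfl

theorem const_mul (c : ℝ) (hf : IsSchwartz f) : IsSchwartz fun x => c * f x :=
  ((SchwartzLocBdd.of_isSchwartz hf).const_mul c).slice le_rfl

theorem sum {ι : Type*} (s : Finset ι) {G : ι → V3 → ℝ} (hG : ∀ i, IsSchwartz (G i)) :
    IsSchwartz fun x => ∑ i ∈ s, G i x :=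
  (SchwartzLocBdd.sum s fun i => .of_isSchwartz (hG i)).slice le_rfl

theorem pdS (j : Fin 3) (hf : IsSchwartz f) : IsSchwartz (pdS j f) :=
  ((SchwartzLocBdd.of_isSchwartz hf).pdS j).slice le_rfl

theorem differentiable (hf : IsSchwartz f) : Differentiable ℝ f := hf.1.differentiable (by simp)

theorem integrable (hf : IsSchwartz f) : Integrable f := by
  obtain ⟨b, hb, hfb⟩ := (SchwartzLocBdd.of_isSchwartz hf).exists_integrable_bound one_pos
  exact hb.mono' hf.1.continuous.aestronglyMeasurable (.of_forall (hfb 0 (by simp)))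

theorem integral_mul_pdS (hf : IsSchwartz f) (hg : IsSchwartz g) (j : Fin 3) :
    ∫ x, f x * _root_.pdS j g x = -∫ x, _root_.pdS j f x * g x :=
  integral_mul_fderiv_eq_neg_fderiv_mul_of_integrable ((hf.pdS j).mul hg).integrable
    (hf.mul (hg.pdS j)).integrable (hf.mul hg).integrable (fun x _ => hf.differentiable x)
    fun x _ => hg.differentiable x

theorem pdS_comm (hf : IsSchwartz f) (j k : Fin 3) :
    _root_.pdS j (_root_.pdS k f) = _root_.pdS k (_root_.pdS j f) := by
  funext x
  have hd : DifferentiableAt ℝ (fderiv ℝ f) x :=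
    (hf.1.fderiv_right (m := (⊤ : ℕ∞)) (by simp)).differentiable (by simp) x
  have key (a b : Fin 3) : _root_.pdS a (_root_.pdS b f) x
      = fderiv ℝ (fderiv ℝ f) x (Pi.single a 1) (Pi.single b 1) := by
    change fderiv ℝ (fun y => fderiv ℝ f y (Pi.single b 1)) x (Pi.single a 1) = _
    rw [fderiv_clm_apply hd (differentiableAt_const _)]
    simp
  rw [key, key]
  have h2 : ((2 : ℕ∞) : WithTop ℕ∞) ≤ ((⊤ : ℕ∞) : WithTop ℕ∞) := by exact_mod_cast le_top
  exact (hf.1.contDiffAt.isSymmSndFDerivAt (by simpa using h2)).eq _ _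

end IsSchwartz

/-- The scalar Laplacian. -/
def lap (g : V3 → ℝ) : V3 → ℝ := fun x => ∑ j, pdS j (pdS j g) x

/-- The Helmholtz operator `1 - α² Δ`. -/
def helm (α : ℝ) (g : V3 → ℝ) : V3 → ℝ := fun x => g x - α ^ 2 * lap g x

theorem SchwartzLocBdd.lap {g : ℝ → V3 → ℝ} (hg : SchwartzLocBdd g) :
    SchwartzLocBdd fun t => lap (g t) :=
  SchwartzLocBdd.sum Finset.univ fun j => (hg.pdS j).pdS j

theorem SchwartzLocBdd.helm (α : ℝ) {g : ℝ → V3 → ℝ} (hg : SchwartzLocBdd g) :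
    SchwartzLocBdd fun t => helm α (g t) :=
  hg.sub (hg.lap.const_mul _)

namespace IsSchwartz

variable {f g : V3 → ℝ}

theorem lap (hf : IsSchwartz f) : IsSchwartz (lap f) :=
  (SchwartzLocBdd.of_isSchwartz hf).lap.slice le_rfl

theorem helm (α : ℝ) (hf : IsSchwartz f) : IsSchwartz (helm α f) :=
  ((SchwartzLocBdd.of_isSchwartz hf).helm α).slice le_rfl

theorem integral_mul_lap (hf : IsSchwartz f) (hg : IsSchwartz g) :
    ∫ x, f x * _root_.lap g x = -∑ j, ∫ x, _root_.pdS j f x * _root_.pdS j g x := by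
  simp only [_root_.lap, Finset.mul_sum]
  rw [integral_finsetSum _ fun j _ => (hf.mul ((hg.pdS j).pdS j)).integrable,
    ← Finset.sum_neg_distrib]
  exact Finset.sum_congr rfl fun j _ => hf.integral_mul_pdS (hg.pdS j) j

theorem integral_mul_lap_comm (hf : IsSchwartz f) (hg : IsSchwartz g) :
    ∫ x, f x * _root_.lap g x = ∫ x, _root_.lap f x * g x := by
  simp only [hf.integral_mul_lap hg, mul_comm (_root_.lap f _), hg.integral_mul_lap hf,
    mul_comm (_root_.pdS _ f _)]

theorem integral_mul_helm (α : ℝ) (hf : IsSchwartz f) (hg : IsSchwartz g) :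
    ∫ x, f x * _root_.helm α g x
      = (∫ x, f x * g x) - α ^ 2 * ∫ x, f x * _root_.lap g x := by
  rw [← integral_const_mul, ← integral_sub (hf.mul hg).integrable
    ((hf.mul hg.lap).const_mul _).integrable]
  exact integral_congr_ae (.of_forall fun x => by simp only [_root_.helm]; ring)

theorem integral_mul_helm_eq (α : ℝ) (hf : IsSchwartz f) (hg : IsSchwartz g) :
    ∫ x, f x * _root_.helm α g x
      = (∫ x, f x * g x) + α ^ 2 * ∑ j, ∫ x, _root_.pdS j f x * _root_.pdS j g x := by
  rw [hf.integral_mul_helm α hg, hf.integral_mul_lap hg]; ring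

theorem integral_mul_helm_comm (α : ℝ) (hf : IsSchwartz f) (hg : IsSchwartz g) :
    ∫ x, f x * _root_.helm α g x = ∫ x, g x * _root_.helm α f x := by
  rw [hf.integral_mul_helm_eq α hg, hg.integral_mul_helm_eq α hf]
  simp only [mul_comm (f _), mul_comm (_root_.pdS _ f _)]

theorem lap_pdS (hf : IsSchwartz f) (i : Fin 3) :
    _root_.lap (_root_.pdS i f) = _root_.pdS i (_root_.lap f) := by
  funext x
  have h : _root_.pdS i (_root_.lap f) x
      = ∑ j, _root_.pdS i (_root_.pdS j (_root_.pdS j f)) x := by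
    change fderiv ℝ (fun y => ∑ j, _root_.pdS j (_root_.pdS j f) y) x _ = _
    rw [fderiv_fun_sum fun j _ => ((hf.pdS j).pdS j).differentiable x]
    simp only [_root_.sum_apply]
    rfl
  rw [h]
  refine Finset.sum_congr rfl fun j _ => ?_
  rw [hf.pdS_comm j i, (hf.pdS j).pdS_comm j i]

theorem integral_lap_mul_lap (hf : IsSchwartz f) :
    ∫ x, _root_.lap f x * _root_.lap f x
      = ∑ j, ∑ k, ∫ x, (_root_.pdS k (_root_.pdS j f) x) ^ 2 := by
  rw [hf.lap.integral_mul_lap hf, ← Finset.sum_neg_distrib]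
  refine Finset.sum_congr rfl fun j _ => ?_
  rw [← hf.lap_pdS j]
  simp only [mul_comm (_root_.lap _ _)]
  rw [(hf.pdS j).integral_mul_lap (hf.pdS j), neg_neg]
  simp only [sq]

theorem integral_lap_mul_helm (α : ℝ) (hf : IsSchwartz f) :
    ∫ x, _root_.lap f x * _root_.helm α f x
      = -((∑ j, ∫ x, (_root_.pdS j f x) ^ 2)
        + α ^ 2 * ∑ j, ∑ k, ∫ x, (_root_.pdS k (_root_.pdS j f) x) ^ 2) := by
  rw [hf.lap.integral_mul_helm α hf, hf.integral_lap_mul_lap, ← hf.integral_mul_lap_comm hf,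
    hf.integral_mul_lap hf]
  simp only [sq]
  ring

theorem two_mul_integral_mul_le {β : ℝ} (hβ : 0 < β) (hf : IsSchwartz f) (hg : IsSchwartz g) :
    2 * ∫ x, f x * g x ≤ β⁻¹ * (∫ x, f x * f x) + β * ∫ x, g x * g x := by
  rw [← integral_const_mul, ← integral_const_mul, ← integral_const_mul, ← integral_add
    ((hf.mul hf).const_mul _).integrable ((hg.mul hg).const_mul _).integrable]
  refine integral_mono ((hf.mul hg).const_mul _).integrable
    (((hf.mul hf).const_mul _).add ((hg.mul hg).const_mul _)).integrable fun x => ?_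
  have : 0 ≤ β⁻¹ * (f x - β * g x) ^ 2 := by positivity
  have h : β⁻¹ * (f x - β * g x) ^ 2
      = β⁻¹ * (f x * f x) + β * (g x * g x) - 2 * (f x * g x) := by
    field_simp
    ring
  simp only
  linarith

theorem two_mul_integral_mul_helm_le (α : ℝ) {β : ℝ} (hβ : 0 < β) (hf : IsSchwartz f)
    (hg : IsSchwartz g) :
    2 * ∫ x, f x * _root_.helm α g x ≤ β⁻¹ * (∫ x, f x * _root_.helm α f x)
      + β * ∫ x, g x * _root_.helm α g x := by
  rw [hf.integral_mul_helm_eq α hg, hf.integral_mul_helm_eq α hf, hg.integral_mul_helm_eq α hg]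
  have h0 := hf.two_mul_integral_mul_le hβ hg
  have h1 := Finset.sum_le_sum fun j (_ : j ∈ Finset.univ) =>
    (hf.pdS j).two_mul_integral_mul_le hβ (hg.pdS j)
  rw [Finset.sum_add_distrib, ← Finset.mul_sum, ← Finset.mul_sum, ← Finset.mul_sum] at h1
  nlinarith [mul_le_mul_of_nonneg_left h1 (sq_nonneg α)]

theorem integral_mul_helm_self_nonneg (α : ℝ) (hf : IsSchwartz f) :
    0 ≤ ∫ x, f x * _root_.helm α f x := by
  rw [hf.integral_mul_helm_eq α hf]
  have h (g : V3 → ℝ) : 0 ≤ ∫ x, g x * g x := integral_nonneg fun x => mul_self_nonneg _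
  exact add_nonneg (h _) (mul_nonneg (sq_nonneg _) (Finset.sum_nonneg fun _ _ => h _))

end IsSchwartz

section Solenoidal

variable {v : Fin 3 → V3 → ℝ}

theorem sum_integral_pdS_mul_eq_zero (hv : ∀ i, IsSchwartz (v i))
    (hdiv : ∀ x, ∑ i, pdS i (v i) x = 0) {q : V3 → ℝ} (hq : IsSchwartz q) :
    ∑ i, ∫ x, pdS i q x * v i x = 0 := by
  have h (i : Fin 3) : ∫ x, pdS i q x * v i x = -∫ x, q x * pdS i (v i) x := by
    rw [hq.integral_mul_pdS (hv i) i, neg_neg]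
  rw [Finset.sum_congr rfl fun i _ => h i, Finset.sum_neg_distrib,
    ← integral_finsetSum _ fun i _ => (hq.mul ((hv i).pdS i)).integrable]
  simp [← Finset.mul_sum, hdiv]

theorem sum_integral_pdS_mul_helm_eq_zero (α : ℝ) (hv : ∀ i, IsSchwartz (v i))
    (hdiv : ∀ x, ∑ i, pdS i (v i) x = 0) {q : V3 → ℝ} (hq : IsSchwartz q) :
    ∑ i, ∫ x, pdS i q x * helm α (v i) x = 0 := by
  have h (i : Fin 3) : ∫ x, pdS i q x * helm α (v i) x
      = (∫ x, pdS i q x * v i x) - α ^ 2 * ∫ x, pdS i (lap q) x * v i x := by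
    rw [(hq.pdS i).integral_mul_helm α (hv i), (hq.pdS i).integral_mul_lap_comm (hv i),
      hq.lap_pdS]
  rw [Finset.sum_congr rfl fun i _ => h i, Finset.sum_sub_distrib, ← Finset.mul_sum,
    sum_integral_pdS_mul_eq_zero hv hdiv hq, sum_integral_pdS_mul_eq_zero hv hdiv hq.lap]
  simp

theorem pdS_mul_self {g : V3 → ℝ} (hg : IsSchwartz g) (j : Fin 3) (x : V3) :
    pdS j (fun y => g y * g y) x = 2 * (g x * pdS j g x) := by
  have := hg.differentiable x
  change fderiv ℝ (fun y => g y * g y) x _ = _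
  rw [fderiv_fun_mul this this]
  simp [pdS]
  ring

theorem sum_integral_mul_advection_eq_zero (hv : ∀ i, IsSchwartz (v i))
    (hdiv : ∀ x, ∑ i, pdS i (v i) x = 0) {g : V3 → ℝ} (hg : IsSchwartz g) :
    ∫ x, g x * ∑ j, v j x * pdS j g x = 0 := by
  have h := sum_integral_pdS_mul_eq_zero hv hdiv (hg.mul hg)
  rw [← integral_finsetSum _ fun i _ => (((hg.mul hg).pdS i).mul (hv i)).integrable] at h
  have h2 : (∫ x, ∑ i, pdS i (fun y => g y * g y) x * v i x)
      = 2 * ∫ x, g x * ∑ j, v j x * pdS j g x := by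
    rw [← integral_const_mul]
    refine integral_congr_ae (.of_forall fun x => ?_)
    simp only [pdS_mul_self hg, Finset.mul_sum]
    exact Finset.sum_congr rfl fun j _ => by ring
  linarith

/-- The right-hand side of the momentum equation, tested against `2 (1 - α² Δ) v`. -/
theorem two_mul_sum_integral_mul_helm_le {α β : ℝ} (ν : ℝ) (hβ : 0 < β)
    {f n : Fin 3 → V3 → ℝ} {p : V3 → ℝ} (hv : ∀ i, IsSchwartz (v i))
    (hf : ∀ i, IsSchwartz (f i)) (hn : ∀ i, IsSchwartz (n i)) (hp : IsSchwartz p)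
    (hdiv : ∀ x, ∑ i, pdS i (v i) x = 0)
    (hfilter : ∀ i x, helm α (n i) x = ∑ j, v j x * pdS j (v i) x) :
    2 * ∑ i, ∫ x, (f i x - β * v i x - pdS i p x + ν * lap (v i) x - n i x) * helm α (v i) x
      ≤ β⁻¹ * (∑ i, ∫ x, f i x * helm α (f i) x)
        - 2 * ν * ∑ i, ((∑ j, ∫ x, (pdS j (v i) x) ^ 2)
          + α ^ 2 * ∑ j, ∑ k, ∫ x, (pdS k (pdS j (v i)) x) ^ 2) := by
  have hexp (i : Fin 3) :
      ∫ x, (f i x - β * v i x - pdS i p x + ν * lap (v i) x - n i x) * helm α (v i) x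
      = (∫ x, f i x * helm α (v i) x) - β * (∫ x, v i x * helm α (v i) x)
        - (∫ x, pdS i p x * helm α (v i) x) + ν * ∫ x, lap (v i) x * helm α (v i) x := by
    have hH := (hv i).helm α
    have hnl : ∫ x, n i x * helm α (v i) x = 0 := by
      rw [(hn i).integral_mul_helm_comm α (hv i)]
      simp only [hfilter]
      exact sum_integral_mul_advection_eq_zero hv hdiv (hv i)
    have i1 := ((hf i).mul hH)
    have i2 := (((hv i).mul hH).const_mul β)
    have i3 := ((hp.pdS i).mul hH)
    have i4 := (((hv i).lap.mul hH).const_mul ν)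
    have i5 := ((hn i).mul hH)
    rw [← sub_zero (_ + _), ← hnl, ← integral_const_mul, ← integral_const_mul,
      ← integral_sub i1.integrable i2.integrable,
      ← integral_sub (i1.sub i2).integrable i3.integrable,
      ← integral_add ((i1.sub i2).sub i3).integrable i4.integrable,
      ← integral_sub (((i1.sub i2).sub i3).add i4).integrable i5.integrable]
    exact integral_congr_ae (.of_forall fun x => by ring)
  have hbd (i : Fin 3) : 2 * (∫ x, f i x * helm α (v i) x)
      - 2 * β * (∫ x, v i x * helm α (v i) x) ≤ β⁻¹ * ∫ x, f i x * helm α (f i) x := by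
    have h1 := (hf i).two_mul_integral_mul_helm_le α hβ (hv i)
    have h2 := mul_nonneg hβ.le ((hv i).integral_mul_helm_self_nonneg α)
    linarith
  have hsum := Finset.sum_le_sum fun i (_ : i ∈ Finset.univ) => hbd i
  rw [Finset.sum_sub_distrib, ← Finset.mul_sum, ← Finset.mul_sum, ← Finset.mul_sum] at hsum
  simp only [hexp, (hv _).integral_lap_mul_helm, Finset.sum_add_distrib, Finset.sum_sub_distrib,
    ← Finset.mul_sum, Finset.sum_neg_distrib, sum_integral_pdS_mul_helm_eq_zero α hv hdiv hp]
  linarith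

end Solenoidal

open Filter Topology in
theorem SchwartzLocBdd.hasDerivAt_integral_mul_helm (α : ℝ) {g d : ℝ → V3 → ℝ}
    (hg : SchwartzLocBdd g) (hd : SchwartzLocBdd d)
    (hder : ∀ t > 0, ∀ x, HasDerivAt (fun s => g s x) (d t x) t) {t : ℝ} (ht : 0 < t) :
    HasDerivAt (fun s => ∫ x, g s x * _root_.helm α (g s) x)
      (2 * ∫ x, d t x * _root_.helm α (g t) x) t := by
  have hH := hg.helm α
  have hT : 0 < t + 1 := by linarith
  obtain ⟨C, hC⟩ := hd.exists_bound hT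
  obtain ⟨b, hb, hHb⟩ := hH.exists_integrable_bound hT
  have hnhds : ∀ᶠ s in 𝓝[≠] t, s ∈ Ioo 0 (t + 1) ∧ s ≠ t := by
    filter_upwards [nhdsWithin_le_nhds (Ioo_mem_nhds ht (lt_add_one t)), self_mem_nhdsWithin]
      with s hs hne using ⟨hs, hne⟩
  rw [hasDerivAt_iff_tendsto_slope]
  have hslope : ∀ᶠ s in 𝓝[≠] t,
      ∫ x, slope (fun s => g s x) t s * (_root_.helm α (g s) x + _root_.helm α (g t) x)
        = slope (fun s => ∫ x, g s x * _root_.helm α (g s) x) t s := by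
    filter_upwards [hnhds] with s hs
    have gs := hg.slice hs.1.1.le
    have gt := hg.slice ht.le
    have hcomm := gs.integral_mul_helm_comm α gt
    simp only [slope_def_field]
    rw [← add_sub_cancel_right (∫ x, g s x * _root_.helm α (g s) x)
      (∫ x, g s x * _root_.helm α (g t) x)]
    nth_rewrite 2 [hcomm]
    rw [← integral_add (gs.mul (gs.helm α)).integrable (gs.mul (gt.helm α)).integrable,
      ← integral_sub ((gs.mul (gs.helm α)).add (gs.mul (gt.helm α))).integrable
        (gt.mul (gs.helm α)).integrable,
      ← integral_sub (((gs.mul (gs.helm α)).add (gs.mul (gt.helm α))).sub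
        (gt.mul (gs.helm α))).integrable (gt.mul (gt.helm α)).integrable, ← integral_div]
    exact integral_congr_ae (.of_forall fun x => by ring)
  refine Tendsto.congr' hslope ?_
  rw [← integral_const_mul]
  refine tendsto_integral_filter_of_dominated_convergence (fun x => C * (b x + b x)) ?_ ?_
    ((hb.add hb).const_mul C) (.of_forall fun x => ?_)
  · filter_upwards [hnhds] with s hs
    have gs := hg.slice hs.1.1.le
    have gt := hg.slice ht.le
    simp only [slope_def_field]
    exact (((gs.sub gt).1.continuous.div_const _).mul
      ((gs.helm α).add (gt.helm α)).1.continuous).aestronglyMeasurable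
  · filter_upwards [hnhds] with s hs
    refine .of_forall fun x => ?_
    have hmv := (convex_Ioo 0 (t + 1)).norm_image_sub_le_of_norm_hasDerivWithin_le
      (f := fun s => g s x) (f' := fun s => d s x)
      (fun r hr => (hder r hr.1 x).hasDerivWithinAt)
      (fun r hr => hC r ⟨hr.1.le, hr.2.le⟩ x) (⟨ht, lt_add_one t⟩ : t ∈ Ioo 0 (t + 1)) hs.1
    have hsl : ‖slope (fun s => g s x) t s‖ ≤ C := by
      rw [slope_def_field, norm_div]
      exact (div_le_iff₀ (norm_pos_iff.2 (sub_ne_zero.2 hs.2))).2 hmv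
    rw [norm_mul]
    exact mul_le_mul hsl ((norm_add_le _ _).trans (add_le_add
      (hHb s ⟨hs.1.1.le, hs.1.2.le⟩ x) (hHb t ⟨ht.le, (lt_add_one t).le⟩ x)))
      (norm_nonneg _) ((norm_nonneg _).trans hsl)
  · have h1 := hasDerivAt_iff_tendsto_slope.1 (hder t ht x)
    have h2 : Tendsto (fun s => _root_.helm α (g s) x) (𝓝[≠] t) (𝓝 (_root_.helm α (g t) x)) :=
      ((hH.contDiffOn_time x).continuousOn.continuousAt (Ici_mem_nhds ht)).tendsto.mono_left
        nhdsWithin_le_nhds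
    convert h1.mul (h2.add_const (_root_.helm α (g t) x)) using 2
    ring

section Components

variable {g : V3 → Fin 3 → ℝ}

theorem IsSchwartz.apply (hg : IsSchwartz g) (i : Fin 3) : IsSchwartz fun x => g x i :=
  ((SchwartzLocBdd.of_isSchwartz hg).clm_comp
    (ContinuousLinearMap.proj (R := ℝ) (φ := fun _ : Fin 3 => ℝ) i)).slice le_rfl

theorem SchwartzLocBdd.apply {g : ℝ → V3 → Fin 3 → ℝ} (hg : SchwartzLocBdd g) (i : Fin 3) :
    SchwartzLocBdd fun t x => g t x i :=
  hg.clm_comp (ContinuousLinearMap.proj (R := ℝ) (φ := fun _ : Fin 3 => ℝ) i)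

theorem pd_apply {x : V3} (hg : DifferentiableAt ℝ g x) (j i : Fin 3) :
    pd j g x i = pdS j (fun y => g y i) x := by
  have h := hasFDerivAt_pi'.1 hg.hasFDerivAt i
  rw [pdS, h.fderiv]
  rfl

theorem IsSchwartz.pd_apply (hg : IsSchwartz g) (j : Fin 3) (x : V3) (i : Fin 3) :
    pd j g x i = _root_.pdS j (fun y => g y i) x :=
  _root_.pd_apply (hg.1.differentiable (by simp) x) j i

theorem IsSchwartz.pd_pd_apply (hg : IsSchwartz g) (k j : Fin 3) (x : V3) (i : Fin 3) :
    pd k (pd j g) x i = _root_.pdS k (_root_.pdS j fun y => g y i) x := by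
  have hd : DifferentiableAt ℝ (pd j g) x :=
    ((hg.1.fderiv_right (m := (⊤ : ℕ∞)) (by simp)).clm_apply contDiff_const).differentiable
      (by simp) x
  rw [_root_.pd_apply hd]
  congr 1
  exact funext fun y => hg.pd_apply j y i

theorem IsSchwartz.sq {f : V3 → ℝ} (hf : IsSchwartz f) : IsSchwartz fun x => f x ^ 2 := by
  simpa only [_root_.sq] using hf.mul hf

theorem IsSchwartz.L2sq_eq (hg : IsSchwartz g) : L2sq g = ∑ i, ∫ x, (g x i) ^ 2 :=
  integral_finsetSum _ fun i _ => (hg.apply i).sq.integrable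

theorem IsSchwartz.H1sq_eq (hg : IsSchwartz g) :
    H1sq g = ∑ i, ∑ j, ∫ x, (_root_.pdS j (fun y => g y i) x) ^ 2 := by
  have h (i j : Fin 3) := ((hg.apply i).pdS j).sq
  simp only [H1sq, hg.pd_apply]
  rw [integral_finsetSum _ fun i _ => (IsSchwartz.sum _ (h i)).integrable]
  exact Finset.sum_congr rfl fun i _ => integral_finsetSum _ fun j _ => (h i j).integrable

theorem IsSchwartz.H2sq_eq (hg : IsSchwartz g) :
    H2sq g = ∑ i, ∑ j, ∑ k, ∫ x, (_root_.pdS k (_root_.pdS j fun y => g y i) x) ^ 2 := by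
  have h (i j k : Fin 3) := (((hg.apply i).pdS j).pdS k).sq
  simp only [H2sq, hg.pd_pd_apply]
  rw [integral_finsetSum _ fun i _ =>
    (IsSchwartz.sum _ fun j => IsSchwartz.sum _ (h i j)).integrable]
  refine Finset.sum_congr rfl fun i _ => ?_
  rw [integral_finsetSum _ fun j _ => (IsSchwartz.sum _ (h i j)).integrable]
  exact Finset.sum_congr rfl fun j _ => integral_finsetSum _ fun k _ => (h i j k).integrable

theorem IsSchwartz.sum_integral_mul_helm (α : ℝ) (hg : IsSchwartz g) :
    ∑ i, ∫ x, g x i * _root_.helm α (fun y => g y i) x = L2sq g + α ^ 2 * H1sq g := by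
  rw [hg.L2sq_eq, hg.H1sq_eq, Finset.mul_sum, ← Finset.sum_add_distrib]
  refine Finset.sum_congr rfl fun i _ => ?_
  rw [(hg.apply i).integral_mul_helm_eq α (hg.apply i)]
  simp only [_root_.sq]

theorem L2sq_nonneg (g : V3 → Fin 3 → ℝ) : 0 ≤ L2sq g :=
  integral_nonneg fun _ => Finset.sum_nonneg fun _ _ => sq_nonneg _

theorem H1sq_nonneg (g : V3 → Fin 3 → ℝ) : 0 ≤ H1sq g :=
  integral_nonneg fun _ => Finset.sum_nonneg fun _ _ => Finset.sum_nonneg fun _ _ => sq_nonneg _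

theorem H2sq_nonneg (g : V3 → Fin 3 → ℝ) : 0 ≤ H2sq g :=
  integral_nonneg fun _ => Finset.sum_nonneg fun _ _ => Finset.sum_nonneg fun _ _ =>
    Finset.sum_nonneg fun _ _ => sq_nonneg _

variable {w : ℝ → V3 → Fin 3 → ℝ}

theorem SchwartzLocBdd.sq {h : ℝ → V3 → ℝ} (hh : SchwartzLocBdd h) :
    SchwartzLocBdd fun t x => h t x ^ 2 := by
  simpa only [_root_.sq] using hh.mul hh

theorem SchwartzLocBdd.continuousOn_H1sq (hw : SchwartzLocBdd w) (T : ℝ) :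
    ContinuousOn (fun t => H1sq (w t)) (Icc 0 T) :=
  (continuousOn_finsetSum _ fun i _ => continuousOn_finsetSum _ fun j _ =>
    ((hw.apply i).pdS j).sq.continuousOn_integral T).congr fun _ ht => (hw.slice ht.1).H1sq_eq

theorem SchwartzLocBdd.continuousOn_H2sq (hw : SchwartzLocBdd w) (T : ℝ) :
    ContinuousOn (fun t => H2sq (w t)) (Icc 0 T) :=
  (continuousOn_finsetSum _ fun i _ => continuousOn_finsetSum _ fun j _ =>
    continuousOn_finsetSum _ fun k _ =>
    (((hw.apply i).pdS j).pdS k).sq.continuousOn_integral T).congr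
      fun _ ht => (hw.slice ht.1).H2sq_eq

end Components

/-- Control of the dissipative terms on time windows `[t, t+T]`. -/
theorem time_control_dissipation (α β ν : ℝ) (hα : 0 < α) (hβ : 0 < β) (hν : 0 < ν)
    (u₀ f : V3 → Fin 3 → ℝ) (hf : IsForce f)
    (sol : ClassicalSolution α β ν u₀ f) (t T : ℝ) (ht : 0 ≤ t) (hT : 0 ≤ T) :
    ν * (∫ s in t..(t + T), H1sq (sol.u s))
      + ν * α^2 * (∫ s in t..(t + T), H2sq (sol.u s))
    ≤ 2 * T / β * (L2sq f + α^2 * H1sq f)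
      + L2sq (sol.u t) + α^2 * H1sq (sol.u t) := by
  obtain ⟨hfS, -⟩ := hf
  have hu (i) := sol.reg_u.apply i
  let v (i : Fin 3) (s : ℝ) (x : V3) : ℝ := sol.u s x i
  let d (i : Fin 3) (s : ℝ) (x : V3) : ℝ := f x i - β * v i s x - pdS i (sol.p s) x
    + ν * lap (v i s) x - sol.N s x i
  let E (s : ℝ) : ℝ := ∑ i, ∫ x, v i s x * helm α (v i s) x
  let φ (s : ℝ) : ℝ := β⁻¹ * (L2sq f + α ^ 2 * H1sq f)
    - 2 * ν * (H1sq (sol.u s) + α ^ 2 * H2sq (sol.u s))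
  have hd (i) : SchwartzLocBdd (d i) :=
    ((((SchwartzLocBdd.of_isSchwartz (hfS.apply i)).sub ((hu i).const_mul β)).sub
      (sol.reg_p.pdS i)).add ((hu i).lap.const_mul ν)).sub (sol.reg_N.apply i)
  have hE {s : ℝ} (hs : 0 ≤ s) : E s = L2sq (sol.u s) + α ^ 2 * H1sq (sol.u s) :=
    (sol.reg_u.slice hs).sum_integral_mul_helm α
  have hder (i) (s : ℝ) (hs : s > 0) (x : V3) : HasDerivAt (fun r => v i r x) (d i s x) s := by
    have hdiff : DifferentiableAt ℝ (fun r => v i r x) s :=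
      (((hu i).contDiffOn_time x).contDiffAt (Ici_mem_nhds hs)).differentiableAt (by simp)
    have hm := sol.momentum s hs.le x i
    rw [derivWithin_of_mem_nhds (Ici_mem_nhds hs)] at hm
    simp only [(sol.reg_u.slice hs.le).pd_pd_apply] at hm
    have hval : deriv (fun r => v i r x) s = d i s x := by
      simp only [d, v, lap]
      linarith
    exact hval ▸ hdiff.hasDerivAt
  have hEder {s : ℝ} (hs : 0 < s) :
      HasDerivAt E (2 * ∑ i, ∫ x, d i s x * helm α (v i s) x) s := by
    rw [Finset.mul_sum]
    exact HasDerivAt.fun_sum fun i _ =>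
      (hu i).hasDerivAt_integral_mul_helm α (hd i) (hder i) hs
  have hEle {s : ℝ} (hs : 0 < s) : 2 * ∑ i, ∫ x, d i s x * helm α (v i s) x ≤ φ s := by
    have huS := sol.reg_u.slice hs.le
    have hNS := sol.reg_N.slice hs.le
    have h := two_mul_sum_integral_mul_helm_le (α := α) ν hβ (fun i => huS.apply i)
      (fun i => hfS.apply i) (fun i => hNS.apply i) (sol.reg_p.slice hs.le)
      (fun x => by simpa only [huS.pd_apply] using sol.divFree s hs.le x)
      (fun i x => by
        have := sol.filter s hs.le x i
        simp only [huS.pd_apply, hNS.pd_pd_apply] at this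
        simp only [helm, lap]
        linarith)
    rw [hfS.sum_integral_mul_helm α, Finset.sum_add_distrib, ← Finset.mul_sum, ← huS.H1sq_eq,
      ← huS.H2sq_eq] at h
    exact h
  have hsub : Icc t (t + T) ⊆ Icc 0 (t + T) := Icc_subset_Icc_left ht
  have hle : t ≤ t + T := by linarith
  have hc1 := (sol.reg_u.continuousOn_H1sq (t + T)).mono hsub
  have hc2 := (sol.reg_u.continuousOn_H2sq (t + T)).mono hsub
  have hEc : ContinuousOn E (Icc t (t + T)) := (continuousOn_finsetSum _ fun i _ =>
    ((hu i).mul ((hu i).helm α)).continuousOn_integral (t + T)).mono hsub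
  have hφc : ContinuousOn φ (Icc t (t + T)) :=
    continuousOn_const.sub (continuousOn_const.mul (hc1.add (continuousOn_const.mul hc2)))
  have hmain := intervalIntegral.sub_le_integral_of_hasDeriv_right_of_le hle hEc
    (fun s hs => (hEder (ht.trans_lt hs.1)).hasDerivWithinAt) hφc.integrableOn_Icc
    (fun s hs => hEle (ht.trans_lt hs.1))
  have hi1 := hc1.intervalIntegrable_of_Icc (μ := volume) hle
  have hi2 := hc2.intervalIntegrable_of_Icc (μ := volume) hle
  have hφint : ∫ s in t..(t + T), φ s = T * (β⁻¹ * (L2sq f + α ^ 2 * H1sq f))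
      - 2 * ν * ((∫ s in t..(t + T), H1sq (sol.u s))
        + α ^ 2 * ∫ s in t..(t + T), H2sq (sol.u s)) := by
    simp only [φ]
    rw [intervalIntegral.integral_sub intervalIntegrable_const
      ((hi1.add (hi2.const_mul _)).const_mul _), intervalIntegral.integral_const_mul (2 * ν),
      intervalIntegral.integral_add hi1 (hi2.const_mul _),
      intervalIntegral.integral_const_mul (α ^ 2), intervalIntegral.integral_const,
      add_sub_cancel_left, smul_eq_mul]
  rw [hφint, hE ht, hE (ht.trans hle)] at hmain
  have hE0 : 0 ≤ L2sq (sol.u (t + T)) + α ^ 2 * H1sq (sol.u (t + T)) :=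
    add_nonneg (L2sq_nonneg _) (mul_nonneg (sq_nonneg _) (H1sq_nonneg _))
  have hF0 : 0 ≤ T * (β⁻¹ * (L2sq f + α ^ 2 * H1sq f)) :=
    mul_nonneg hT (mul_nonneg (inv_pos.2 hβ).le
      (add_nonneg (L2sq_nonneg _) (mul_nonneg (sq_nonneg _) (H1sq_nonneg _))))
  have hD0 : 0 ≤ ν * ((∫ s in t..(t + T), H1sq (sol.u s))
      + α ^ 2 * ∫ s in t..(t + T), H2sq (sol.u s)) :=
    mul_nonneg hν.le (add_nonneg
      (intervalIntegral.integral_nonneg hle fun _ _ => H1sq_nonneg _)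
      (mul_nonneg (sq_nonneg _)
        (intervalIntegral.integral_nonneg hle fun _ _ => H2sq_nonneg _)))
  have hrw : 2 * T / β * (L2sq f + α ^ 2 * H1sq f)
      = 2 * (T * (β⁻¹ * (L2sq f + α ^ 2 * H1sq f))) := by
    rw [div_eq_mul_inv]; ring
  rw [hrw]
  linarith

end
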